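/- Let Y ⊆ A^+ be a finite set of nonempty words. For each w, z ∈ Y^{←*} and each factorization w = w1 w2 with w1, w2 ∈ A*, one has w1 z w2 ∈ Y^{←*}. -/

import Mathlib

/-- One insertion step: `w` is obtained from `u` by inserting a word of `Y`. -/
def InsStep {A : Type*} (Y : Set (List A)) (u w : List A) : Prop :=
  ∃ u1 u2 y : List A, y ∈ Y ∧ u = u1 ++ u2 ∧ w = u1 ++ y ++ u2

/-- The derivation quasi-order `≤_Y`: reflexive-transitive closure of `⇒_Y`. -/
def DerivLE {A : Type*} (Y : Set (List A)) : List A → List A → Prop :=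
  Relation.ReflTransGen (InsStep Y)

/-- The pure unitary language of the pure unitary grammar `(A, Y)`:
all words derivable from the empty word. -/
def unitaryLang {A : Type*} (Y : Set (List A)) : Set (List A) :=
  {w | DerivLE Y [] w}

/-- Iterated insertion: `Y^{←0} = {1}` and `Y^{←(i+1)} = Y^{←i} ← Y`. -/
def iterIns {A : Type*} (Y : Set (List A)) : ℕ → Set (List A)
  | 0 => {[]}
  | i + 1 => {w | ∃ z ∈ iterIns Y i, InsStep Y z w}

/-- `Y^{←*} = ⋃_{i ≥ 0} Y^{←i}`. -/
def iterInsStar {A : Type*} (Y : Set (List A)) : Set (List A) :=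
  ⋃ i, iterIns Y i

/-- For a finite set `Y ⊆ A^+` of nonempty words: if `w, z ∈ Y^{←*}` and `w = w1 w2`,
then `w1 z w2 ∈ Y^{←*}`. -/
theorem stmt12 {A : Type} (Y : Set (List A))
    (hfin : Y.Finite) (hne : ∀ y ∈ Y, y ≠ [])
    (w z : List A) (hw : w ∈ iterInsStar Y) (hz : z ∈ iterInsStar Y)
    (w1 w2 : List A) (hsplit : w = w1 ++ w2) :
    w1 ++ z ++ w2 ∈ iterInsStar Y := by
  subst hsplit
  obtain ⟨n, hn⟩ := Set.mem_iUnion.1 hz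
  clear hz
  induction n generalizing z with
  | zero =>
    have h0 : z = [] := hn
    subst h0
    simpa using hw
  | succ k ih =>
    obtain ⟨v, hv, u1, u2, y, hy, rfl, rfl⟩ := hn
    obtain ⟨m, hm⟩ := Set.mem_iUnion.1 (ih _ hv)
    refine Set.mem_iUnion.2 ⟨m + 1, _, hm, w1 ++ u1, u2 ++ w2, y, hy, ?_, ?_⟩ <;> simp
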